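/- Let d ≥ 1, let μ be a norm on ℝ^d, and let T : ℤ^d → [0,∞) be a function such that (T(x) − μ(x))/‖x‖₁ → 0 as ‖x‖₁ → ∞ (where ℤ^d is viewed as a subset of ℝ^d). For t > 0 define G_t := {x ∈ ℤ^d : T(x) ≤ t} + [−1/2, 1/2]^d ⊆ ℝ^d (Minkowski sum) and let B_μ := {z ∈ ℝ^d : μ(z) ≤ 1}. Then for every ε ∈ (0,1) there exists s ≥ 0 such that for all t ≥ s one has t(1−ε)B_μ ⊆ G_t ⊆ t(1+ε)B_μ. -/

import Mathlib

/-!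
STATEMENT 0: deterministic shape theorem from convergence of hitting times to a norm.
`ℤ^d` is modelled as `Fin d → ℤ`, viewed inside `ℝ^d = Fin d → ℝ` via coordinatewise cast.
-/

open Finset
open scoped Pointwise

/-- The `ℓ¹`-norm of a lattice point, as a real number. -/
noncomputable def latL1 {d : ℕ} (x : Fin d → ℤ) : ℝ := ∑ i, |(x i : ℝ)|

/-- The embedding of `ℤ^d` into `ℝ^d`. -/
def latCast {d : ℕ} (x : Fin d → ℤ) : Fin d → ℝ := fun i => (x i : ℝ)

/-- `G_t = {x ∈ ℤ^d : T x ≤ t} + [-1/2, 1/2]^d` as a subset of `ℝ^d` (Minkowski sum). -/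
def growthSet {d : ℕ} (T : (Fin d → ℤ) → ℝ) (t : ℝ) : Set (Fin d → ℝ) :=
  {z | ∃ x : Fin d → ℤ, T x ≤ t ∧ ∃ c : Fin d → ℝ,
    (∀ i, c i ∈ Set.Icc (-(1/2) : ℝ) (1/2)) ∧ z = latCast x + c}

theorem aux_upper {d : ℕ} (μ : (Fin d → ℝ) → ℝ)
    (hμ_zero : ∀ z, μ z = 0 ↔ z = 0)
    (hμ_smul : ∀ (a : ℝ) (z : Fin d → ℝ), μ (a • z) = |a| * μ z)
    (hμ_add : ∀ z w : Fin d → ℝ, μ (z + w) ≤ μ z + μ w)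
    (hnn : ∀ z, 0 ≤ μ z) :
    ∃ M : ℝ, 0 ≤ M ∧ ∀ z, μ z ≤ M * ∑ i, |z i| := by
  refine ⟨∑ i, μ (Pi.single i 1), Finset.sum_nonneg fun i _ => hnn _, fun z => ?_⟩
  have h1 : ∀ s : Finset (Fin d), μ (∑ i ∈ s, z i • Pi.single i (1:ℝ)) ≤
      ∑ i ∈ s, |z i| * μ (Pi.single i 1) := by
    intro s
    induction s using Finset.induction_on with
    | empty => simp [(hμ_zero 0).2 rfl]
    | insert a s ha ih =>
      rw [Finset.sum_insert ha, Finset.sum_insert ha]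
      have := hμ_add (z a • Pi.single a (1:ℝ)) (∑ i ∈ s, z i • Pi.single i (1:ℝ))
      rw [hμ_smul] at this
      linarith
  have h2 : z = ∑ i, z i • (Pi.single i (1:ℝ) : Fin d → ℝ) := by
    ext j
    simp [Finset.sum_apply, Pi.single_apply]
  have h3 := h1 Finset.univ
  rw [← h2] at h3
  refine h3.trans ?_
  rw [Finset.mul_sum]
  refine Finset.sum_le_sum fun i _ => ?_
  rw [mul_comm]
  exact mul_le_mul_of_nonneg_right
    (Finset.single_le_sum (f := fun i => μ (Pi.single i 1)) (fun i _ => hnn _) (Finset.mem_univ i))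
    (abs_nonneg _)

theorem aux_lower {d : ℕ} (hd : 1 ≤ d) (μ : (Fin d → ℝ) → ℝ)
    (hμ_zero : ∀ z, μ z = 0 ↔ z = 0)
    (hμ_smul : ∀ (a : ℝ) (z : Fin d → ℝ), μ (a • z) = |a| * μ z)
    (hμ_add : ∀ z w : Fin d → ℝ, μ (z + w) ≤ μ z + μ w)
    (hnn : ∀ z, 0 ≤ μ z) (M : ℝ) (hM0 : 0 ≤ M) (hM : ∀ z, μ z ≤ M * ∑ i, |z i|) :
    ∃ c : ℝ, 0 < c ∧ ∀ z : Fin d → ℝ, c * ∑ i, |z i| ≤ μ z := by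
  have hdpos : (0:ℝ) < d := by exact_mod_cast hd
  have hN : ∀ z : Fin d → ℝ, ∑ i, |z i| ≤ d * ‖z‖ := by
    intro z
    have := Finset.sum_le_sum (s := Finset.univ) (f := fun i => |z i|) (g := fun _ => ‖z‖)
      (fun i _ => norm_le_pi_norm z i)
    simpa using this
  have hcont : Continuous μ := by
    refine (LipschitzWith.of_le_add_mul (Real.toNNReal (M * d)) fun z w => ?_).continuous
    rw [Real.coe_toNNReal _ (by positivity), dist_eq_norm]
    have h1 := hμ_add w (z - w)
    rw [add_sub_cancel] at h1
    have h2 := hM (z - w)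
    have h3 := mul_le_mul_of_nonneg_left (hN (z - w)) hM0
    rw [mul_assoc]
    linarith
  have : Nonempty (Fin d) := ⟨⟨0, hd⟩⟩
  have hne : (Metric.sphere (0 : Fin d → ℝ) 1).Nonempty :=
    NormedSpace.sphere_nonempty.2 zero_le_one
  obtain ⟨y, hy, hmin⟩ := (isCompact_sphere (0 : Fin d → ℝ) 1).exists_isMinOn hne
    hcont.continuousOn
  have hy1 : ‖y‖ = 1 := by simpa using hy
  have hypos : 0 < μ y := by
    refine lt_of_le_of_ne (hnn y) fun h => ?_
    rw [(hμ_zero y).1 h.symm] at hy1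
    simp at hy1
  refine ⟨μ y / d, by positivity, fun z => ?_⟩
  have key : μ y * ‖z‖ ≤ μ z := by
    by_cases hz : z = 0
    · subst hz
      simp [hnn]
    have hzp : 0 < ‖z‖ := norm_pos_iff.2 hz
    have h1 : μ y ≤ μ (‖z‖⁻¹ • z) := hmin (by simp [norm_smul, hzp.ne'])
    rw [hμ_smul, abs_of_pos (by positivity)] at h1
    have h2 := mul_le_mul_of_nonneg_right h1 hzp.le
    have h3 : ‖z‖⁻¹ * μ z * ‖z‖ = μ z := by field_simp
    linarith
  calc μ y / d * ∑ i, |z i| ≤ μ y / d * (d * ‖z‖) := by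
        apply mul_le_mul_of_nonneg_left (hN z) (by positivity)
    _ = μ y * ‖z‖ := by field_simp
    _ ≤ μ z := key

theorem aux_fin {d : ℕ} (T : (Fin d → ℤ) → ℝ) (R : ℝ) :
    ∃ B : ℝ, ∀ x : Fin d → ℤ, latL1 x < R → T x ≤ B := by
  have hfin : {x : Fin d → ℤ | latL1 x < R}.Finite := by
    refine (Set.finite_Icc (fun _ : Fin d => -⌈R⌉) (fun _ => ⌈R⌉)).subset fun x hx => ?_
    have h : ∀ i, |x i| ≤ ⌈R⌉ := by
      intro i
      have h1 : |(x i : ℝ)| ≤ latL1 x :=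
        Finset.single_le_sum (f := fun i => |(x i : ℝ)|) (fun i _ => abs_nonneg _)
          (Finset.mem_univ i)
      have h2 : ((|x i| : ℤ) : ℝ) ≤ (⌈R⌉ : ℝ) := by
        push_cast
        exact h1.trans ((le_of_lt hx).trans (Int.le_ceil R))
      exact_mod_cast h2
    exact ⟨fun i => (abs_le.1 (h i)).1, fun i => (abs_le.1 (h i)).2⟩
  obtain ⟨B, hB⟩ := (hfin.image T).bddAbove
  exact ⟨B, fun x hx => hB ⟨x, hx, rfl⟩⟩

theorem stmt0 (d : ℕ) (hd : 1 ≤ d) (μ : (Fin d → ℝ) → ℝ)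
    (hμ_zero : ∀ z, μ z = 0 ↔ z = 0)
    (hμ_smul : ∀ (a : ℝ) (z : Fin d → ℝ), μ (a • z) = |a| * μ z)
    (hμ_add : ∀ z w : Fin d → ℝ, μ (z + w) ≤ μ z + μ w)
    (T : (Fin d → ℤ) → ℝ)
    (hT : ∀ ε : ℝ, 0 < ε → ∃ R : ℝ, ∀ x : Fin d → ℤ,
      R ≤ latL1 x → |T x - μ (latCast x)| ≤ ε * latL1 x) :
    ∀ ε : ℝ, 0 < ε → ε < 1 → ∃ s : ℝ, 0 ≤ s ∧ ∀ t : ℝ, s ≤ t →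
      (t * (1 - ε)) • {z : Fin d → ℝ | μ z ≤ 1} ⊆ growthSet T t ∧
      growthSet T t ⊆ (t * (1 + ε)) • {z : Fin d → ℝ | μ z ≤ 1} := by
  have hnn : ∀ z, 0 ≤ μ z := by
    intro z
    have h1 := hμ_add z ((-1 : ℝ) • z)
    rw [hμ_smul] at h1
    have h2 : z + (-1 : ℝ) • z = 0 := by simp
    rw [h2, (hμ_zero 0).2 rfl] at h1
    simp at h1
    linarith
  obtain ⟨M, hM0, hM⟩ := aux_upper μ hμ_zero hμ_smul hμ_add hnn
  obtain ⟨c, hc, hlow⟩ := aux_lower hd μ hμ_zero hμ_smul hμ_add hnn M hM0 hM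
  intro ε hε hε1
  obtain ⟨R, hR⟩ := hT (c * (ε / 4)) (by positivity)
  obtain ⟨B, hB⟩ := aux_fin T R
  have hR' : ∀ x : Fin d → ℤ, R ≤ latL1 x →
      |T x - μ (latCast x)| ≤ ε / 4 * μ (latCast x) := by
    intro x hx
    have h1 : c * latL1 x ≤ μ (latCast x) := hlow (latCast x)
    have h2 := mul_le_mul_of_nonneg_left h1 (by positivity : 0 ≤ ε / 4)
    have h3 := hR x hx
    linarith
  obtain ⟨K, hK⟩ : ∃ K : ℝ, K = M * (d * (1 / 2)) := ⟨_, rfl⟩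
  have hK0 : 0 ≤ K := by rw [hK]; positivity
  have hcube : ∀ w : Fin d → ℝ, (∀ i, |w i| ≤ 1 / 2) → μ w ≤ K := by
    intro w hw
    refine (hM w).trans ?_
    rw [hK]
    refine mul_le_mul_of_nonneg_left ?_ hM0
    have := Finset.sum_le_sum (s := Finset.univ) (f := fun i => |w i|) (g := fun _ => (1 / 2 : ℝ))
      (fun i _ => hw i)
    simpa using this
  have hMR : 0 ≤ M * |R| := by positivity
  have hKe : 0 ≤ 8 * K / ε := by positivity
  refine ⟨8 * K / ε + |B| + M * |R| + K + 1, by positivity, fun t ht => ?_⟩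
  have hB1 := le_abs_self B
  have hB2 := abs_nonneg B
  have ht0 : 0 < t := by linarith
  have htK : 8 * K ≤ t * ε := by
    rw [← div_le_iff₀ hε]
    linarith
  constructor
  · rintro z ⟨u, hu, rfl⟩
    have hu1 : μ u ≤ 1 := hu
    have hp : 0 < t * (1 - ε) := mul_pos ht0 (by linarith)
    obtain ⟨z, hz⟩ : ∃ z, z = (t * (1 - ε)) • u := ⟨_, rfl⟩
    have hμz : μ z ≤ t * (1 - ε) := by
      rw [hz, hμ_smul, abs_of_pos hp]
      nlinarith
    show (t * (1 - ε)) • u ∈ growthSet T t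
    rw [← hz]
    have hw : ∀ i, |z i - (round (z i) : ℝ)| ≤ 1 / 2 := fun i => abs_sub_round (z i)
    refine ⟨fun i => round (z i), ?_, fun i => z i - (round (z i) : ℝ),
      fun i => abs_le.1 (hw i), ?_⟩
    swap
    · ext i
      simp [latCast]
    rcases lt_or_ge (latL1 fun i => round (z i)) R with h | h
    · have := hB _ h
      linarith
    · have h1 := (abs_le.1 (hR' _ h)).2
      have h2 : μ (latCast fun i => round (z i)) ≤ t * (1 - ε) + K := by
        have h3 := hμ_add z ((-1 : ℝ) • fun i => z i - (round (z i) : ℝ))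
        rw [hμ_smul] at h3
        have h4 := hcube _ hw
        have h5 : (z + (-1 : ℝ) • fun i => z i - (round (z i) : ℝ)) =
            latCast fun i => round (z i) := by
          ext i
          simp [latCast]
        rw [h5] at h3
        simp only [abs_neg, abs_one, one_mul] at h3
        linarith
      have h6 := mul_le_mul_of_nonneg_left h2 (by positivity : 0 ≤ 1 + ε / 4)
      nlinarith [mul_nonneg hK0 hε.le, mul_nonneg ht0.le (sq_nonneg ε), mul_nonneg hK0 (by linarith : 0 ≤ 1 - ε)]
  · rintro z ⟨x, hx, w, hw, rfl⟩
    have hp : 0 < t * (1 + ε) := by positivity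
    have hμw : μ w ≤ K := hcube w fun i => abs_le.2 (hw i)
    have hadd := hμ_add (latCast x) w
    have hmain : μ (latCast x + w) ≤ t * (1 + ε) := by
      have hte : 0 ≤ t * ε := by positivity
      rcases lt_or_ge (latL1 x) R with h | h
      · have h1 : μ (latCast x) ≤ M * latL1 x := hM _
        have h2 : M * latL1 x ≤ M * |R| :=
          mul_le_mul_of_nonneg_left (h.le.trans (le_abs_self R)) hM0
        linarith
      · have h1 := (abs_le.1 (hR' _ h)).1
        have h2 : μ (latCast x) * (1 - ε / 4) ≤ t := by linarith
        have h3 : μ (latCast x) ≤ t * (1 + ε / 2) := by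
          have h4 := mul_le_mul_of_nonneg_right h2 (by positivity : 0 ≤ 1 + ε / 2)
          have h5 : 0 ≤ μ (latCast x) * (ε * (1 - ε / 2)) :=
            mul_nonneg (hnn _) (mul_nonneg hε.le (by linarith))
          nlinarith
        linarith
    rw [Set.mem_smul_set_iff_inv_smul_mem₀ hp.ne']
    show μ _ ≤ 1
    rw [hμ_smul, abs_of_pos (by positivity), inv_mul_le_iff₀ hp]
    linarith
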